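/- arXiv:2005.05812 — 2 statements merged into one kernel-verified Lean document; each statement's English description precedes it below -/
import Mathlib

section
/- For every finite, simple, connected, undirected k-regular graph G, the Cheeger constant satisfies the lower bound (k - λ_1(G))/2 ≤ h(G), where λ_1(G) is the second largest eigenvalue of the adjacency matrix of G. -/
open scoped Classical

/-- The edge boundary `∂F` of a finite vertex set `F`: the set of edges of `G`
with exactly one endpoint in `F`. -/
noncomputable def edgeBoundary {V : Type*} [Fintype V] (G : SimpleGraph V)
    (F : Finset V) : Finset (Sym2 V) :=
  G.edgeFinset.filter fun e => ∃ a ∈ F, ∃ b ∉ F, e = s(a, b)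

/-- The Cheeger constant (isoperimetric constant / edge expansion constant)
`h(G) = min { |∂F|/|F| : F ⊆ V nonempty, |F| ≤ |V|/2 }`. -/
noncomputable def cheegerConstant {V : Type*} [Fintype V] (G : SimpleGraph V) : ℝ :=
  sInf {x : ℝ | ∃ F : Finset V, F.Nonempty ∧ 2 * F.card ≤ Fintype.card V ∧
    x = (edgeBoundary G F).card / F.card}

theorem adjMatrix_isHermitian {n : ℕ} (G : SimpleGraph (Fin n)) :
    (G.adjMatrix ℝ).IsHermitian := by
  show Matrix.conjTranspose (G.adjMatrix ℝ) = G.adjMatrix ℝ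
  rw [Matrix.conjTranspose_eq_transpose_of_trivial]
  exact G.isSymm_adjMatrix

/-- The list of eigenvalues of the adjacency matrix of `G`, with multiplicity,
sorted in decreasing order: `λ_0(G) ≥ λ_1(G) ≥ ⋯ ≥ λ_{n-1}(G)`. -/
noncomputable def adjacencySpectrum {n : ℕ} (G : SimpleGraph (Fin n)) : List ℝ :=
  ((Finset.univ.val.map (adjMatrix_isHermitian G).eigenvalues).sort (· ≤ ·)).reverse

/-- `λ_1(G)`, the second largest eigenvalue (with multiplicity) of the
adjacency matrix of `G`. -/
noncomputable def secondLargestEigenvalue {n : ℕ} (G : SimpleGraph (Fin n)) : ℝ :=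
  (adjacencySpectrum G).getD 1 0

open Matrix

/-- In a family of reals whose values sorted decreasingly are `l`, all members but one are
at most the second entry of `l`. -/
theorem exists_forall_ne_le_getD_one {ι : Type*} [Fintype ι] (f : ι → ℝ)
    (hcard : 2 ≤ Fintype.card ι) :
    ∃ i₀, ∀ i, i ≠ i₀ →
      f i ≤ ((Finset.univ.val.map f).sort (· ≤ ·)).reverse.getD 1 0 := by
  set l := ((Finset.univ.val.map f).sort (· ≤ ·)).reverse with hl
  have hcoe : (l : Multiset ℝ) = Finset.univ.val.map f := by
    rw [hl, Multiset.coe_reverse, Multiset.sort_eq]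
  have hsorted : l.Pairwise (· ≥ ·) := by
    rw [hl, List.pairwise_reverse]
    exact Multiset.pairwise_sort _ _
  have hlen : l.length = Fintype.card ι := by
    have := congrArg Multiset.card hcoe
    simpa using this
  clear_value l
  match l, hlen with
  | [], h => simp at h; omega
  | [_], h => simp at h; omega
  | a :: b :: t, _ =>
    have ha : a ∈ Finset.univ.val.map f := by rw [← hcoe]; simp
    obtain ⟨i₀, -, hi₀⟩ := Multiset.mem_map.1 ha
    refine ⟨i₀, fun i hi => ?_⟩
    have hrest : ((b :: t : List ℝ) : Multiset ℝ) = (Finset.univ.erase i₀).val.map f := by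
      rw [← Multiset.cons_inj_right a, Multiset.cons_coe, hcoe, ← hi₀, ← Multiset.map_cons,
        Finset.erase_val, Multiset.cons_erase (Finset.mem_univ_val i₀)]
    have hmem : f i ∈ ((b :: t : List ℝ) : Multiset ℝ) := by
      rw [hrest]
      exact Multiset.mem_map_of_mem f (Finset.mem_erase.2 ⟨hi, Finset.mem_univ i⟩)
    rw [Multiset.mem_coe, List.mem_cons] at hmem
    rcases hmem with h | h
    · simp [h]
    · simpa using (List.pairwise_cons.1 (List.pairwise_cons.1 hsorted).2).1 _ h

/-- Parseval's identity for the eigenvector basis of a real symmetric matrix. -/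
theorem Matrix.IsHermitian.dotProduct_eq_sum_eigenvectorBasis {ι : Type*} [Fintype ι]
    [DecidableEq ι] {A : Matrix ι ι ℝ} (hA : A.IsHermitian) (x y : ι → ℝ) :
    x ⬝ᵥ y = ∑ i, (x ⬝ᵥ ⇑(hA.eigenvectorBasis i)) * (⇑(hA.eigenvectorBasis i) ⬝ᵥ y) := by
  have h := hA.eigenvectorBasis.sum_inner_mul_inner (WithLp.toLp 2 x) (WithLp.toLp 2 y)
  simp only [EuclideanSpace.inner_eq_star_dotProduct, star_trivial] at h
  rw [dotProduct_comm x y, ← h]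
  refine Finset.sum_congr rfl fun i _ => ?_
  rw [dotProduct_comm x, dotProduct_comm _ y]

/-- A real symmetric matrix acts on the coefficients in its eigenvector basis by scaling. -/
theorem Matrix.IsHermitian.eigenvectorBasis_dotProduct_mulVec {ι : Type*} [Fintype ι]
    [DecidableEq ι] {A : Matrix ι ι ℝ} (hA : A.IsHermitian) (i : ι) (x : ι → ℝ) :
    ⇑(hA.eigenvectorBasis i) ⬝ᵥ A *ᵥ x =
      hA.eigenvalues i * (⇑(hA.eigenvectorBasis i) ⬝ᵥ x) := by
  have hT : Aᵀ = A := by rw [← conjTranspose_eq_transpose_of_trivial]; exact hA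
  rw [dotProduct_mulVec, ← mulVec_transpose, hT, hA.mulVec_eigenvectorBasis, smul_dotProduct,
    smul_eq_mul]

/-- If all eigenvalues of a real symmetric matrix but one are at most `μ`, the Rayleigh quotient
is at most `μ` on the orthogonal complement of any nonzero eigenvector with eigenvalue
above `μ`. -/
theorem Matrix.IsHermitian.dotProduct_mulVec_le_of_orthogonal {ι : Type*} [Fintype ι]
    [DecidableEq ι] {A : Matrix ι ι ℝ} (hA : A.IsHermitian) {μ κ : ℝ} {i₀ : ι}
    (hμ : ∀ i, i ≠ i₀ → hA.eigenvalues i ≤ μ) (hκ : μ < κ) {u : ι → ℝ} (hu : u ≠ 0)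
    (hAu : A *ᵥ u = κ • u) {x : ι → ℝ} (hx : x ⬝ᵥ u = 0) :
    x ⬝ᵥ A *ᵥ x ≤ μ * (x ⬝ᵥ x) := by
  have hcoef : ∀ i, i ≠ i₀ → ⇑(hA.eigenvectorBasis i) ⬝ᵥ u = 0 := by
    intro i hi
    have h := hA.eigenvectorBasis_dotProduct_mulVec i u
    rw [hAu, dotProduct_smul, smul_eq_mul] at h
    have h' : (κ - hA.eigenvalues i) * (⇑(hA.eigenvectorBasis i) ⬝ᵥ u) = 0 := by linarith
    rcases mul_eq_zero.1 h' with h0 | h0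
    · linarith [hμ i hi]
    · exact h0
  have hexp : ∀ y, y ⬝ᵥ u =
      (y ⬝ᵥ ⇑(hA.eigenvectorBasis i₀)) * (⇑(hA.eigenvectorBasis i₀) ⬝ᵥ u) := by
    intro y
    rw [hA.dotProduct_eq_sum_eigenvectorBasis]
    exact Finset.sum_eq_single i₀ (fun i _ hi => by rw [hcoef i hi, mul_zero]) (by simp)
  have hx₀ : x ⬝ᵥ ⇑(hA.eigenvectorBasis i₀) = 0 := by
    rw [hexp] at hx
    refine (mul_eq_zero.1 hx).resolve_right fun h => hu ?_
    rw [← dotProduct_self_eq_zero, hexp, h, mul_zero]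
  rw [hA.dotProduct_eq_sum_eigenvectorBasis x (A *ᵥ x),
    hA.dotProduct_eq_sum_eigenvectorBasis x x, Finset.mul_sum]
  refine Finset.sum_le_sum fun i _ => ?_
  rw [hA.eigenvectorBasis_dotProduct_mulVec, dotProduct_comm _ x]
  by_cases hi : i = i₀
  · subst hi
    simp [hx₀]
  · nlinarith [mul_le_mul_of_nonneg_right (hμ i hi)
      (mul_self_nonneg (x ⬝ᵥ ⇑(hA.eigenvectorBasis i)))]

/-- The edge boundary of `F` has at least as many edges as there are adjacent pairs leaving `F`. -/
theorem sum_adj_le_card_edgeBoundary {V : Type*} [Fintype V] (G : SimpleGraph V)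
    (F : Finset V) :
    ∑ i ∈ F, ∑ j ∈ Fᶜ, (if G.Adj i j then (1 : ℝ) else 0) ≤ (edgeBoundary G F).card := by
  rw [← Finset.sum_product', Finset.sum_boole]
  norm_cast
  refine Finset.card_le_card_of_injOn (fun p => s(p.1, p.2)) ?_ ?_
  · rintro ⟨a, b⟩ h
    simp only [Finset.coe_filter, Finset.mem_product, Finset.mem_compl, Set.mem_ofPred_eq] at h
    simp only [edgeBoundary, Finset.coe_filter, Set.mem_ofPred_eq, SimpleGraph.mem_edgeFinset,
      SimpleGraph.mem_edgeSet]
    exact ⟨h.2, a, h.1.1, b, h.1.2, rfl⟩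
  · rintro ⟨a, b⟩ h ⟨c, d⟩ h' heq
    simp only [Finset.coe_filter, Finset.mem_product, Finset.mem_compl, Set.mem_ofPred_eq] at h h'
    rcases Sym2.eq_iff.1 heq with ⟨h1, h2⟩ | ⟨h1, h2⟩
    · exact Prod.ext h1 h2
    · exact absurd ((show a = d from h1) ▸ h.1.1) h'.1.2

/-- Summing over `F`, the vertices of a `k`-regular graph have `k * |F|` neighbours, counted with
multiplicity, of which at most `|∂F|` lie outside `F`. -/
theorem card_mul_sub_card_edgeBoundary_le {V : Type*} [Fintype V] {G : SimpleGraph V} {k : ℕ}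
    (hreg : G.IsRegularOfDegree k) (F : Finset V) :
    (k : ℝ) * F.card - (edgeBoundary G F).card ≤
      ∑ i ∈ F, ∑ j ∈ F, (if G.Adj i j then (1 : ℝ) else 0) := by
  have hdeg : ∑ i ∈ F, ∑ j, (if G.Adj i j then (1 : ℝ) else 0) = k * F.card := by
    have : ∀ i, ∑ j, (if G.Adj i j then (1 : ℝ) else 0) = k := by
      intro i
      rw [Finset.sum_boole, ← hreg.degree_eq i, ← SimpleGraph.card_neighborFinset_eq_degree,
        SimpleGraph.neighborFinset_eq_filter]
    simp [this, mul_comm]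
  simp_rw [← Finset.sum_add_sum_compl F (fun j => if G.Adj _ j then (1 : ℝ) else 0),
    Finset.sum_add_distrib] at hdeg
  linarith [sum_adj_le_card_edgeBoundary G F]

/-- The spectral lower bound on the edge boundary of a vertex set in a `k`-regular graph. -/
theorem sub_secondLargestEigenvalue_mul_le_card_edgeBoundary {n k : ℕ}
    {G : SimpleGraph (Fin n)} (hreg : G.IsRegularOfDegree k) (hn : 2 ≤ n)
    (hlt : secondLargestEigenvalue G < k) (F : Finset (Fin n)) :
    ((k : ℝ) - secondLargestEigenvalue G) * (F.card * (n - F.card)) ≤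
      n * (edgeBoundary G F).card := by
  obtain ⟨i₀, hi₀⟩ := exists_forall_ne_le_getD_one (adjMatrix_isHermitian G).eigenvalues
    (by simpa using hn)
  have hnpos : (0 : ℝ) < n := by positivity
  set A := G.adjMatrix ℝ with hAdef
  set μ := secondLargestEigenvalue G with hμ
  set u : Fin n → ℝ := fun _ => 1 with hu
  set w : Fin n → ℝ := fun i => if i ∈ F then 1 else 0 with hw
  set s : ℝ := (F.card : ℝ) with hs
  have hAu : A *ᵥ u = (k : ℝ) • u := by
    ext i
    simp [hAdef, hu, SimpleGraph.adjMatrix_mulVec_apply, hreg.degree_eq i]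
  have hu0 : u ≠ 0 := fun h => one_ne_zero (congrFun h ⟨0, by omega⟩)
  have huu : u ⬝ᵥ u = n := by simp [hu, dotProduct]
  have hwu : w ⬝ᵥ u = s := by simp [hu, hw, hs, dotProduct]
  have hww : w ⬝ᵥ w = s := by simp [hw, hs, dotProduct]
  have hwAw : k * s - (edgeBoundary G F).card ≤ w ⬝ᵥ A *ᵥ w := by
    refine (card_mul_sub_card_edgeBoundary_le hreg F).trans_eq ?_
    simp [hw, hAdef, dotProduct, mulVec, SimpleGraph.adjMatrix_apply]
  have huAw : u ⬝ᵥ A *ᵥ w = k * s := by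
    rw [dotProduct_mulVec, ← mulVec_transpose, hAdef, SimpleGraph.transpose_adjMatrix, ← hAdef,
      hAu, smul_dotProduct, dotProduct_comm, hwu, smul_eq_mul]
  have hx : ((n : ℝ) • w - s • u) ⬝ᵥ u = 0 := by
    simp only [sub_dotProduct, smul_dotProduct, smul_eq_mul, hwu, huu]
    ring
  have hR := (adjMatrix_isHermitian G).dotProduct_mulVec_le_of_orthogonal hi₀ hlt hu0 hAu hx
  change _ ≤ μ * _ at hR
  rw [← hAdef] at hR
  simp only [mulVec_sub, mulVec_smul, sub_dotProduct, dotProduct_sub, smul_dotProduct,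
    dotProduct_smul, smul_eq_mul, hAu, hwu, huu, hww, huAw, dotProduct_comm u w] at hR
  refine le_of_mul_le_mul_left ?_ hnpos
  nlinarith [mul_le_mul_of_nonneg_left hwAw (mul_self_nonneg (n : ℝ))]

/-- For every finite, simple, connected, undirected `k`-regular graph `G`, the
Cheeger constant satisfies `(k - λ_1(G))/2 ≤ h(G)`. -/
theorem cheeger_lower_bound {n k : ℕ} (G : SimpleGraph (Fin n))
    (hconn : G.Connected) (hreg : G.IsRegularOfDegree k) :
    ((k : ℝ) - secondLargestEigenvalue G) / 2 ≤ cheegerConstant G := by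
  have hnonneg : 0 ≤ cheegerConstant G := by
    refine Real.sInf_nonneg ?_
    rintro _ ⟨F, -, -, rfl⟩
    positivity
  by_cases hlt : secondLargestEigenvalue G < k
  · have := hconn.nonempty
    have hpos : 0 < n := Fin.pos_iff_nonempty.2 this
    rcases lt_or_ge n 2 with hn | hn
    · obtain rfl : n = 1 := by omega
      have hk : k = 0 := by
        have := G.degree_lt_card_verts 0
        rw [hreg.degree_eq 0, Fintype.card_fin] at this
        omega
      have hμ : secondLargestEigenvalue G = 0 := by
        refine List.getD_eq_default _ _ ?_
        simp [adjacencySpectrum]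
      simpa [hk, hμ] using hnonneg
    · refine le_csInf ?_ ?_
      · exact ⟨_, {⟨0, hpos⟩}, Finset.singleton_nonempty _, by simpa using hn, rfl⟩
      · rintro _ ⟨F, hF, hcard, rfl⟩
        have hs : (0 : ℝ) < F.card := by exact_mod_cast hF.card_pos
        have h2 : 2 * (F.card : ℝ) ≤ n := by
          rw [Fintype.card_fin] at hcard
          exact_mod_cast hcard
        have hb := sub_secondLargestEigenvalue_mul_le_card_edgeBoundary hreg hn hlt F
        have hn0 : (0 : ℝ) < n := by exact_mod_cast hpos
        rw [le_div_iff₀ hs]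
        refine le_of_mul_le_mul_left ?_ hn0
        refine le_trans ?_ hb
        have hc := mul_pos (sub_pos.2 hlt) hs
        nlinarith [mul_nonneg hc.le (sub_nonneg.2 h2)]
  · linarith
end

section
/- For every finite, simple, connected, undirected k-regular graph G, the Cheeger constant satisfies the upper bound h(G) ≤ √(2k(k - λ_1(G))), where λ_1(G) is the second largest eigenvalue of the adjacency matrix of G. -/
open scoped Classical

open Finset Matrix

section Cheeger

variable {V : Type*} [Fintype V] (G : SimpleGraph V)

/-- The ordered pairs of adjacent vertices of `G`. -/
noncomputable def adjPairs : Finset (V × V) :=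
  Finset.univ.filter fun p => G.Adj p.1 p.2

theorem sum_adjPairs (f : V → V → ℝ) :
    ∑ p ∈ adjPairs G, f p.1 p.2 = ∑ u, ∑ v, if G.Adj u v then f u v else 0 := by
  rw [adjPairs, Finset.sum_filter, Fintype.sum_prod_type]

theorem sum_adjPairs_swap (f : V → V → ℝ) :
    ∑ p ∈ adjPairs G, f p.2 p.1 = ∑ p ∈ adjPairs G, f p.1 p.2 := by
  rw [sum_adjPairs, sum_adjPairs G fun u v => f v u, Finset.sum_comm]
  simp_rw [G.adj_comm]

variable {G} in
theorem sum_adjPairs_fst {k : ℕ} (hreg : G.IsRegularOfDegree k) (f : V → ℝ) :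
    ∑ p ∈ adjPairs G, f p.1 = k * ∑ u, f u := by
  rw [sum_adjPairs G fun u _ => f u, Finset.mul_sum]
  refine Finset.sum_congr rfl fun u _ => ?_
  rw [← Finset.sum_filter, Finset.sum_const, ← G.neighborFinset_eq_filter,
    SimpleGraph.card_neighborFinset_eq_degree, hreg u, nsmul_eq_mul]

theorem card_edgeBoundary_le (F : Finset V) :
    ((edgeBoundary G F).card : ℝ) ≤
      (∑ p ∈ adjPairs G, |(if p.1 ∈ F then (1 : ℝ) else 0) - if p.2 ∈ F then 1 else 0|) / 2 := by
  have hsub : edgeBoundary G F ⊆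
      ((adjPairs G).filter fun p => p.1 ∈ F ∧ p.2 ∉ F).image fun p => s(p.1, p.2) := by
    intro e he
    simp only [edgeBoundary, Finset.mem_filter, SimpleGraph.mem_edgeFinset] at he
    obtain ⟨hadj, a, ha, b, hb, rfl⟩ := he
    exact Finset.mem_image.2 ⟨(a, b), by simp_all [adjPairs], rfl⟩
  have hcard : ((edgeBoundary G F).card : ℝ) ≤
      ∑ p ∈ adjPairs G, if p.1 ∈ F ∧ p.2 ∉ F then (1 : ℝ) else 0 := by
    rw [← Finset.sum_filter, Finset.sum_const, nsmul_eq_mul, mul_one]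
    exact_mod_cast (Finset.card_le_card hsub).trans Finset.card_image_le
  have hsum : ∑ p ∈ adjPairs G, |(if p.1 ∈ F then (1 : ℝ) else 0) - if p.2 ∈ F then 1 else 0| =
      ∑ p ∈ adjPairs G, (if p.1 ∈ F ∧ p.2 ∉ F then (1 : ℝ) else 0) +
        ∑ p ∈ adjPairs G, if p.2 ∈ F ∧ p.1 ∉ F then (1 : ℝ) else 0 := by
    rw [← Finset.sum_add_distrib]
    refine Finset.sum_congr rfl fun p _ => ?_
    by_cases h1 : p.1 ∈ F <;> by_cases h2 : p.2 ∈ F <;> simp [h1, h2]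
  rw [sum_adjPairs_swap G fun u v => if u ∈ F ∧ v ∉ F then (1 : ℝ) else 0] at hsum
  linarith

theorem cheegerConstant_nonneg : 0 ≤ cheegerConstant G :=
  Real.sInf_nonneg <| by rintro x ⟨F, -, -, rfl⟩; positivity

theorem cheegerConstant_mul_card_le {F : Finset V} (hF : 2 * F.card ≤ Fintype.card V) :
    cheegerConstant G * F.card ≤ (edgeBoundary G F).card := by
  rcases F.eq_empty_or_nonempty with rfl | hne
  · simp
  rw [← le_div_iff₀ (by exact_mod_cast hne.card_pos)]
  exact csInf_le ⟨0, by rintro x ⟨F, -, -, rfl⟩; positivity⟩ ⟨F, hne, hF, rfl⟩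

/-- The discrete co-area inequality for a nonnegative function supported on at most half of the
vertices. -/
theorem cheegerConstant_mul_sum_le (f : V → ℝ) (hf : ∀ v, 0 ≤ f v)
    (hsupp : 2 * (Finset.univ.filter fun v => f v ≠ 0).card ≤ Fintype.card V) :
    cheegerConstant G * ∑ v, f v ≤ (∑ p ∈ adjPairs G, |f p.1 - f p.2|) / 2 := by
  induction hN : (Finset.univ.filter fun v => f v ≠ 0).card using Nat.strong_induction_on
    generalizing f with
  | _ N ih =>
  set S := Finset.univ.filter fun v => f v ≠ 0 with hS
  rcases S.eq_empty_or_nonempty with he | hne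
  · have h0 : ∀ v, f v = 0 := fun v => by
      by_contra h
      exact Finset.notMem_empty v (he ▸ by simp [hS, h])
    simp [h0]
  obtain ⟨w, hwS, hw⟩ := S.exists_min_image f hne
  have hout : ∀ v, v ∉ S → f v = 0 := fun v hv => by simpa [hS] using hv
  let g : V → ℝ := fun v => f v - if v ∈ S then f w else 0
  have hg : ∀ v, 0 ≤ g v := fun v => by
    by_cases hv : v ∈ S
    · simpa [g, hv] using hw v hv
    · simp [g, hv, hf v]
  have hlt : (Finset.univ.filter fun v => g v ≠ 0) ⊂ S := by
    refine Finset.ssubset_iff_of_subset (fun v hv => ?_) |>.2 ⟨w, hwS, by simp [g, hwS]⟩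
    by_contra hvS
    simp [g, hvS, hout v hvS] at hv
  have hcard := Finset.card_lt_card hlt
  have key := ih _ (hN ▸ hcard) g hg (by omega) rfl
  have hsum : ∑ v, f v = ∑ v, g v + f w * S.card := by
    simp [g, Finset.sum_sub_distrib, mul_comm]
  have habs : ∑ p ∈ adjPairs G, |f p.1 - f p.2| = ∑ p ∈ adjPairs G, |g p.1 - g p.2| +
      f w * ∑ p ∈ adjPairs G,
        |(if p.1 ∈ S then (1 : ℝ) else 0) - if p.2 ∈ S then 1 else 0| := by
    rw [Finset.mul_sum, ← Finset.sum_add_distrib]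
    refine Finset.sum_congr rfl fun p _ => ?_
    have hw0 := hf w
    by_cases h1 : p.1 ∈ S <;> by_cases h2 : p.2 ∈ S
    · simp [g, h1, h2]
    · have := hw _ h1
      simp [g, h1, h2, hout _ h2, abs_of_nonneg (hf p.1), abs_of_nonneg (sub_nonneg.2 this)]
    · have := hw _ h2
      simp [g, h1, h2, hout _ h1, abs_of_nonneg (hf p.2), abs_sub_comm (f w),
        abs_of_nonneg (sub_nonneg.2 this)]
    · simp [g, h1, h2]
  have hcut := mul_le_mul_of_nonneg_left
    ((cheegerConstant_mul_card_le G hsupp).trans (card_edgeBoundary_le G S)) (hf w)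
  rw [hsum, habs]
  linarith

variable {G} in
/-- A nonnegative function supported on at most half of the vertices bounds the Cheeger constant
through its Rayleigh quotient. -/
theorem cheegerConstant_sq_le_of_dirichlet_le {k : ℕ} (hreg : G.IsRegularOfDegree k) {c : ℝ}
    (f : V → ℝ) (hf : ∀ v, 0 ≤ f v) (hne : ∃ v, f v ≠ 0)
    (hsupp : 2 * (Finset.univ.filter fun v => f v ≠ 0).card ≤ Fintype.card V)
    (hE : (∑ p ∈ adjPairs G, (f p.1 - f p.2) ^ 2) / 2 ≤ c * ∑ v, f v ^ 2) :
    cheegerConstant G ^ 2 ≤ 2 * k * c := by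
  have hcoarea := cheegerConstant_mul_sum_le G (fun v => f v ^ 2) (fun v => sq_nonneg _)
    (by simpa using hsupp)
  have hpos : 0 < ∑ v, f v ^ 2 := by
    obtain ⟨v, hv⟩ := hne
    exact Finset.sum_pos' (fun v _ => sq_nonneg _) ⟨v, Finset.mem_univ v, by positivity⟩
  have hcs := Finset.sum_mul_sq_le_sq_mul_sq (adjPairs G) (fun p => |f p.1 - f p.2|)
    (fun p => f p.1 + f p.2)
  have hfac : ∀ p : V × V, |f p.1 - f p.2| * (f p.1 + f p.2) = |f p.1 ^ 2 - f p.2 ^ 2| := by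
    intro p
    rw [sq_sub_sq, abs_mul, abs_of_nonneg (add_nonneg (hf p.1) (hf p.2)), mul_comm]
  simp only [hfac, sq_abs] at hcs
  have hplus : ∑ p ∈ adjPairs G, (f p.1 + f p.2) ^ 2 ≤ 4 * k * ∑ v, f v ^ 2 := by
    have h1 := sum_adjPairs_fst hreg fun v => f v ^ 2
    have h2 := sum_adjPairs_swap G fun u _ => f u ^ 2
    calc ∑ p ∈ adjPairs G, (f p.1 + f p.2) ^ 2
        ≤ ∑ p ∈ adjPairs G, (2 * f p.1 ^ 2 + 2 * f p.2 ^ 2) :=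
          Finset.sum_le_sum fun p _ => by nlinarith [sq_nonneg (f p.1 - f p.2)]
      _ = 4 * k * ∑ v, f v ^ 2 := by
          rw [Finset.sum_add_distrib, ← Finset.mul_sum, ← Finset.mul_sum, h2, h1]; ring
  have hD : 0 ≤ ∑ p ∈ adjPairs G, (f p.1 - f p.2) ^ 2 :=
    Finset.sum_nonneg fun p _ => sq_nonneg _
  set N := ∑ v, f v ^ 2
  set D := ∑ p ∈ adjPairs G, (f p.1 - f p.2) ^ 2
  have hsq : (cheegerConstant G * N) ^ 2 ≤
      ((∑ p ∈ adjPairs G, |f p.1 ^ 2 - f p.2 ^ 2|) / 2) ^ 2 :=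
    pow_le_pow_left₀ (mul_nonneg (cheegerConstant_nonneg G) hpos.le) hcoarea 2
  have hDP : D * ∑ p ∈ adjPairs G, (f p.1 + f p.2) ^ 2 ≤ (2 * (c * N)) * (4 * k * N) :=
    mul_le_mul (by linarith) hplus (Finset.sum_nonneg fun p _ => sq_nonneg _) (by linarith)
  refine le_of_mul_le_mul_right ?_ (pow_pos hpos 2)
  nlinarith

variable [DecidableEq V]

theorem dirichlet_eq_dotProduct_lapMatrix (f : V → ℝ) :
    (∑ p ∈ adjPairs G, (f p.1 - f p.2) ^ 2) / 2 = f ⬝ᵥ (G.lapMatrix ℝ *ᵥ f) := by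
  rw [sum_adjPairs G fun u v => (f u - f v) ^ 2, ← SimpleGraph.lapMatrix_toLinearMap₂',
    Matrix.toLinearMap₂'_apply']

variable {G}

theorem lapMatrix_mulVec_of_adjMatrix_mulVec {k : ℕ} (hreg : G.IsRegularOfDegree k) {μ : ℝ}
    {g : V → ℝ} (hg : G.adjMatrix ℝ *ᵥ g = μ • g) :
    G.lapMatrix ℝ *ᵥ g = ((k : ℝ) - μ) • g := by
  ext v
  have hv := congrFun hg v
  rw [SimpleGraph.adjMatrix_mulVec_apply] at hv
  rw [SimpleGraph.lapMatrix_mulVec_apply, hv, hreg v]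
  simp [sub_mul]

/-- An eigenvector that is positive somewhere, but on at most half of the vertices, bounds the
Cheeger constant. -/
theorem cheegerConstant_sq_le_of_eigenvector {k : ℕ} (hreg : G.IsRegularOfDegree k) {μ : ℝ}
    {g : V → ℝ} (hg : G.adjMatrix ℝ *ᵥ g = μ • g) (hne : ∃ v, 0 < g v)
    (hsupp : 2 * (Finset.univ.filter fun v => 0 < g v).card ≤ Fintype.card V) :
    cheegerConstant G ^ 2 ≤ 2 * k * (k - μ) := by
  have hpos : ∀ v, max (g v) 0 ≠ 0 ↔ 0 < g v := fun v => by simp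
  refine cheegerConstant_sq_le_of_dirichlet_le hreg (fun v => max (g v) 0)
    (fun v => le_max_right _ _) (by simpa only [hpos] using hne)
    (by simpa only [hpos] using hsupp) ?_
  rw [dirichlet_eq_dotProduct_lapMatrix G fun v => max (g v) 0, dotProduct, Finset.mul_sum]
  refine Finset.sum_le_sum fun v _ => ?_
  rcases le_or_gt (g v) 0 with hv | hv
  · simp [max_eq_right hv]
  have hL := congrFun (lapMatrix_mulVec_of_adjMatrix_mulVec hreg hg) v
  rw [SimpleGraph.lapMatrix_mulVec_apply, Pi.smul_apply, smul_eq_mul] at hL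
  have hle : ∑ u ∈ G.neighborFinset v, g u ≤ ∑ u ∈ G.neighborFinset v, max (g u) 0 :=
    Finset.sum_le_sum fun u _ => le_max_left _ _
  rw [SimpleGraph.lapMatrix_mulVec_apply, max_eq_left hv.le]
  nlinarith

theorem sum_eq_zero_of_adjMatrix_mulVec {k : ℕ} (hreg : G.IsRegularOfDegree k) {μ : ℝ}
    (hμ : μ ≠ k) {g : V → ℝ} (hg : G.adjMatrix ℝ *ᵥ g = μ • g) : ∑ v, g v = 0 := by
  have hL := lapMatrix_mulVec_of_adjMatrix_mulVec hreg hg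
  have h : (fun _ => (1 : ℝ)) ⬝ᵥ (G.lapMatrix ℝ *ᵥ g) = 0 := by
    rw [dotProduct_mulVec, ← mulVec_transpose, (G.isSymm_lapMatrix (R := ℝ)).eq,
      SimpleGraph.lapMatrix_mulVec_const_eq_zero, zero_dotProduct]
  rw [hL, dotProduct_smul, smul_eq_mul] at h
  simpa [dotProduct] using (mul_eq_zero.1 h).resolve_left (sub_ne_zero.2 hμ.symm)

theorem cheegerConstant_sq_le_of_ne {k : ℕ} (hreg : G.IsRegularOfDegree k) {μ : ℝ}
    (hμ : μ ≠ k) {g : V → ℝ} (hg : G.adjMatrix ℝ *ᵥ g = μ • g) (hne : g ≠ 0) :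
    cheegerConstant G ^ 2 ≤ 2 * k * (k - μ) := by
  have hsum := sum_eq_zero_of_adjMatrix_mulVec hreg hμ hg
  obtain ⟨w, hw⟩ := Function.ne_iff.1 hne
  obtain ⟨a, -, ha⟩ := Finset.exists_pos_of_sum_zero_of_exists_nonzero g hsum
    ⟨w, Finset.mem_univ w, hw⟩
  obtain ⟨b, -, hb⟩ := Finset.exists_pos_of_sum_zero_of_exists_nonzero (fun v => -g v)
    (by simpa using hsum) ⟨w, Finset.mem_univ w, by simpa using hw⟩
  have hdisj : Disjoint (Finset.univ.filter fun v => 0 < g v)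
      (Finset.univ.filter fun v => 0 < -g v) :=
    Finset.disjoint_filter.2 fun v _ h h' => by linarith
  have hcard := Finset.card_le_univ
    ((Finset.univ.filter fun v => 0 < g v).disjUnion _ hdisj)
  rw [Finset.card_disjUnion] at hcard
  by_cases hp : 2 * (Finset.univ.filter fun v => 0 < g v).card ≤ Fintype.card V
  · exact cheegerConstant_sq_le_of_eigenvector hreg hg ⟨a, ha⟩ hp
  · refine cheegerConstant_sq_le_of_eigenvector (g := -g) hreg ?_ ⟨b, hb⟩ ?_
    · rw [mulVec_neg, hg, smul_neg]
    · simp only [Pi.neg_apply]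
      omega

/-- In a connected `k`-regular graph, eigenvectors for eigenvalues at least `k` are constant. -/
theorem eq_of_adjMatrix_mulVec_of_le {k : ℕ} (hconn : G.Connected)
    (hreg : G.IsRegularOfDegree k) {μ : ℝ} (hμ : (k : ℝ) ≤ μ) {g : V → ℝ}
    (hg : G.adjMatrix ℝ *ᵥ g = μ • g) (u v : V) : g u = g v := by
  have hL := lapMatrix_mulVec_of_adjMatrix_mulVec hreg hg
  refine (G.lapMatrix_toLinearMap₂'_apply'_eq_zero_iff_forall_reachable g).1 ?_ u v
    (hconn.preconnected u v)
  refine le_antisymm ?_ ?_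
  · rw [Matrix.toLinearMap₂'_apply', hL, dotProduct_smul, smul_eq_mul]
    exact mul_nonpos_of_nonpos_of_nonneg (by linarith)
      (Finset.sum_nonneg fun v _ => mul_self_nonneg _)
  · rw [SimpleGraph.lapMatrix_toLinearMap₂']
    positivity

end Cheeger

theorem exists_eigenvalues_eq_secondLargestEigenvalue {n : ℕ} (hn : 2 ≤ n)
    (G : SimpleGraph (Fin n)) :
    ∃ i j, i ≠ j ∧ (adjMatrix_isHermitian G).eigenvalues i = secondLargestEigenvalue G ∧
      secondLargestEigenvalue G ≤ (adjMatrix_isHermitian G).eigenvalues j := by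
  have hlen : (adjacencySpectrum G).length = n := by simp [adjacencySpectrum]
  have hcoe : (adjacencySpectrum G : Multiset ℝ) =
      Finset.univ.val.map (adjMatrix_isHermitian G).eigenvalues := by
    rw [adjacencySpectrum, Multiset.coe_reverse, Multiset.sort_eq]
  have hsorted : (adjacencySpectrum G).Pairwise (· ≥ ·) :=
    List.pairwise_reverse.2 (Multiset.pairwise_sort _ _)
  unfold secondLargestEigenvalue
  match hl : adjacencySpectrum G with
  | [] | [_] => simp [hl] at hlen; omega
  | a :: b :: t =>
    rw [hl] at hcoe hsorted
    rw [← Multiset.cons_coe] at hcoe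
    obtain ⟨j, -, hj, hrest⟩ := (Multiset.map_eq_cons _ _ _ _).2 hcoe.symm
    rw [← Multiset.cons_coe] at hrest
    obtain ⟨i, hi, hib, -⟩ := (Multiset.map_eq_cons _ _ _ _).2 hrest
    refine ⟨i, j, ?_, hib, hj.symm ▸ ?_⟩
    · exact ((Finset.univ.nodup.mem_erase_iff).1 hi).1
    · exact (List.pairwise_cons.1 hsorted).1 b (by simp)

/-- In a connected `k`-regular graph on at least two vertices, `λ_1(G) < k`. -/
theorem secondLargestEigenvalue_lt {n k : ℕ} (hn : 2 ≤ n) (G : SimpleGraph (Fin n))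
    (hconn : G.Connected) (hreg : G.IsRegularOfDegree k) :
    secondLargestEigenvalue G < k := by
  obtain ⟨i, j, hij, hi, hj⟩ := exists_eigenvalues_eq_secondLargestEigenvalue hn G
  set hA := adjMatrix_isHermitian G
  by_contra! hk
  have hconst := fun l (hl : (k : ℝ) ≤ hA.eigenvalues l) =>
    eq_of_adjMatrix_mulVec_of_le hconn hreg hl (hA.mulVec_eigenvectorBasis l)
  have hci := hconst i (hi ▸ hk)
  have hcj := hconst j (hk.trans hj)
  let o : Fin n := ⟨0, by omega⟩
  have hne : ∀ l, (∀ u v, hA.eigenvectorBasis l u = hA.eigenvectorBasis l v) →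
      hA.eigenvectorBasis l o ≠ 0 := fun l hl h0 =>
    hA.eigenvectorBasis.orthonormal.ne_zero l (by ext v; rw [hl v o, h0]; rfl)
  have horth : inner ℝ (hA.eigenvectorBasis i) (hA.eigenvectorBasis j) = 0 :=
    hA.eigenvectorBasis.orthonormal.2 hij
  rw [PiLp.inner_apply] at horth
  simp only [fun v => hci v o, fun v => hcj v o] at horth
  simp [hne i hci, hne j hcj] at horth
  omega

/-- For every finite, simple, connected, undirected `k`-regular graph `G`, the
Cheeger constant satisfies `h(G) ≤ √(2k(k - λ_1(G)))`. -/
theorem cheeger_upper_bound_spectral_gap {n k : ℕ} (G : SimpleGraph (Fin n))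
    (hconn : G.Connected) (hreg : G.IsRegularOfDegree k) :
    cheegerConstant G ≤ Real.sqrt (2 * (k : ℝ) * ((k : ℝ) - secondLargestEigenvalue G)) := by
  rcases lt_or_ge n 2 with hn | hn
  · have h0 : cheegerConstant G = 0 := by
      rw [cheegerConstant]
      convert Real.sInf_empty
      refine Set.eq_empty_of_forall_notMem ?_
      rintro x ⟨F, hF, hcard, -⟩
      have := hF.card_pos
      rw [Fintype.card_fin] at hcard
      omega
    exact h0 ▸ Real.sqrt_nonneg _
  obtain ⟨i, -, -, hi, -⟩ := exists_eigenvalues_eq_secondLargestEigenvalue hn G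
  refine Real.le_sqrt_of_sq_le <| cheegerConstant_sq_le_of_ne hreg
    (secondLargestEigenvalue_lt hn G hconn hreg).ne
    (hi ▸ (adjMatrix_isHermitian G).mulVec_eigenvectorBasis i) fun h => ?_
  exact (adjMatrix_isHermitian G).eigenvectorBasis.orthonormal.ne_zero i
    (by ext v; exact congrFun h v)
end
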